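/- arXiv:2009.10860 — 2 statements merged into one kernel-verified Lean document; each statement's English description precedes it below -/
import Mathlib

section
/- If a = 1, b = τ and τ² ≠ 2, then λ = 0 is a root of algebraic multiplicity exactly 2 of the characteristic function χ of the inverted pendulum linearized at the upright equilibrium: χ(0) = 0, χ'(0) = 0, and the second complex derivative of χ at 0 equals 2 − τ², which is nonzero. This is the double-zero point where the Hopf bifurcation curve meets the pitchfork bifurcation line at b = τ, a = 1. -/
theorem hasDerivAt_exp_neg_mul (c z : ℂ) :
    HasDerivAt (fun w : ℂ => Complex.exp (-w * c)) (-c * Complex.exp (-z * c)) z := by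
  refine ((hasDerivAt_id z).neg.mul_const c).cexp.congr_deriv ?_
  simp [mul_comm]

/-- If `a = 1`, `b = τ` and `τ² ≠ 2`, then `λ = 0` is a root
of algebraic multiplicity exactly `2` of the characteristic function
`χ(λ) = λ² + b·λ·e^{−λτ} + a·e^{−λτ} − 1`: `χ(0) = 0`, `χ'(0) = 0`, and
`χ''(0) = 2 − τ² ≠ 0` (the double-zero point where the Hopf curve meets the
pitchfork line at `b = τ`, `a = 1`). -/
theorem pendulum_zero_double_root
    (a b τ : ℝ) (ha : a = 1) (hb : b = τ) (hτ : τ ^ 2 ≠ 2) (χ : ℂ → ℂ)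
    (hχ : ∀ lam : ℂ, χ lam =
      lam ^ 2 + (b : ℂ) * lam * Complex.exp (-lam * (τ : ℂ))
        + (a : ℂ) * Complex.exp (-lam * (τ : ℂ)) - 1) :
    χ 0 = 0 ∧ deriv χ 0 = 0 ∧
      iteratedDeriv 2 χ 0 = 2 - (τ : ℂ) ^ 2 ∧ iteratedDeriv 2 χ 0 ≠ 0 := by
  subst ha hb
  have hexp := hasDerivAt_exp_neg_mul (b : ℂ)
  have hderiv : deriv χ = fun z => 2 * z - (b : ℂ) ^ 2 * z * Complex.exp (-z * b) := by
    funext z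
    rw [funext hχ]
    refine HasDerivAt.deriv (HasDerivAt.congr_deriv (((((hasDerivAt_id z).pow 2).add
      (((hasDerivAt_id z).const_mul (b : ℂ)).mul (hexp z))).add
      ((hexp z).const_mul ((1 : ℝ) : ℂ))).sub_const 1) ?_)
    simp only [id, Complex.ofReal_one]
    push_cast
    ring
  have hsecond : iteratedDeriv 2 χ 0 = 2 - (b : ℂ) ^ 2 := by
    rw [iteratedDeriv_succ, iteratedDeriv_one, hderiv]
    refine HasDerivAt.deriv (HasDerivAt.congr_deriv (((hasDerivAt_id (0 : ℂ)).const_mul 2).sub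
      (((hasDerivAt_id (0 : ℂ)).const_mul ((b : ℂ) ^ 2)).mul (hexp 0))) ?_)
    simp
  refine ⟨by simp [hχ], by simp [hderiv], hsecond, ?_⟩
  rw [hsecond, sub_ne_zero]
  exact_mod_cast hτ.symm
end

section
/- At the parameter point (a, b, τ) = (1, √2, √2), λ = 0 is a root of algebraic multiplicity exactly 3 of the characteristic function χ of the inverted pendulum linearized at the upright equilibrium: χ(0) = 0, χ'(0) = 0, χ''(0) = 0, and the third complex derivative of χ at 0 equals 4√2, which is nonzero. (This is the codimension-three triple-zero singularity at the critical delay τ* = √2.) -/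
/-- The derivative of an affine function times `z ↦ exp (-z * s)` is of the same form. -/
theorem hasDerivAt_affine_mul_cexp (p q s z : ℂ) :
    HasDerivAt (fun w : ℂ => (p + q * w) * Complex.exp (-w * s))
      ((q - s * p + -(s * q) * z) * Complex.exp (-z * s)) z := by
  have h_affine : HasDerivAt (fun w : ℂ => p + q * w) q z := by
    simpa using ((hasDerivAt_id z).const_mul q).const_add p
  have h_exp : HasDerivAt (fun w : ℂ => Complex.exp (-w * s))
      (Complex.exp (-z * s) * (-1 * s)) z :=
    ((hasDerivAt_id z).neg.mul_const s).cexp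
  exact (h_affine.mul h_exp).congr_deriv (by ring)

/-- At `(a, b, τ) = (1, √2, √2)`, `λ = 0` is a root of
algebraic multiplicity exactly `3` of the characteristic function
`χ(λ) = λ² + b·λ·e^{−λτ} + a·e^{−λτ} − 1`: `χ(0) = 0`, `χ'(0) = 0`,
`χ''(0) = 0`, and `χ'''(0) = 4√2 ≠ 0` (the codimension-three triple-zero
singularity at the critical delay `τ* = √2`). -/
theorem pendulum_zero_triple_root
    (a b τ : ℝ) (ha : a = 1) (hb : b = Real.sqrt 2) (hτ : τ = Real.sqrt 2)
    (χ : ℂ → ℂ)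
    (hχ : ∀ lam : ℂ, χ lam =
      lam ^ 2 + (b : ℂ) * lam * Complex.exp (-lam * (τ : ℂ))
        + (a : ℂ) * Complex.exp (-lam * (τ : ℂ)) - 1) :
    χ 0 = 0 ∧ deriv χ 0 = 0 ∧ iteratedDeriv 2 χ 0 = 0 ∧
      iteratedDeriv 3 χ 0 = 4 * (Real.sqrt 2 : ℂ) ∧ iteratedDeriv 3 χ 0 ≠ 0 := by
  subst ha hb hτ
  set s : ℂ := (Real.sqrt 2 : ℂ) with hs
  have hs_sq : s * s = 2 := by
    rw [hs, ← Complex.ofReal_mul, Real.mul_self_sqrt zero_le_two, Complex.ofReal_ofNat]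
  have hs_ne : s ≠ 0 := by
    intro h
    simp [h] at hs_sq
  have hχ_eq : χ = fun z => z ^ 2 - 1 + (1 + s * z) * Complex.exp (-z * s) := by
    funext z
    rw [hχ z, Complex.ofReal_one]
    ring
  have h_deriv : deriv χ = fun z => 2 * z + (0 + -2 * z) * Complex.exp (-z * s) := by
    funext z
    rw [hχ_eq]
    refine ((((hasDerivAt_pow 2 z).sub_const 1).add
      (hasDerivAt_affine_mul_cexp 1 s s z)).congr_deriv ?_).deriv
    rw [hs_sq]
    push_cast
    ring
  have h_deriv_two : iteratedDeriv 2 χ =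
      fun z => 2 + (-2 + 2 * s * z) * Complex.exp (-z * s) := by
    funext z
    rw [iteratedDeriv_succ, iteratedDeriv_one, h_deriv]
    refine ((((hasDerivAt_id z).const_mul 2).add
      (hasDerivAt_affine_mul_cexp 0 (-2) s z)).congr_deriv ?_).deriv
    ring
  have h_deriv_three : iteratedDeriv 3 χ 0 = 4 * s := by
    rw [iteratedDeriv_succ, h_deriv_two]
    refine (((hasDerivAt_affine_mul_cexp (-2) (2 * s) s 0).const_add 2).congr_deriv ?_).deriv
    rw [neg_zero, zero_mul, Complex.exp_zero]
    ring
  refine ⟨?_, ?_, ?_, h_deriv_three, ?_⟩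
  · simp [hχ_eq]
  · simp [h_deriv]
  · simp [h_deriv_two]
  · rw [h_deriv_three]
    exact mul_ne_zero (by norm_num) hs_ne
end
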